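/- arXiv:1302.4063 — 2 statements merged into one kernel-verified Lean document; each statement's English description precedes it below -/
import Mathlib

section
/- For every integer n ≥ 3, in the set S_n(123,132): f_{213}(S_n(123,132)) = (n−3)·2^{n−2} + 1; f_{231}(S_n(123,132)) = f_{312}(S_n(123,132)) = (n²−5n+8)·2^{n−3} − 1; and 3·f_{321}(S_n(123,132)) = (n³−6n²+14n−15)·2^{n−2} + 3 (i.e., f_{321}(S_n(123,132)) = (n³/3 − 2n² + 14n/3 − 5)·2^{n−2} + 1). -/
open Finset

/-- Number of occurrences of the length-3 pattern `q` (given by its sequence of values)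
in the permutation `σ` of `Fin n`: triples of indices `ι 0 < ι 1 < ι 2` whose values under
`σ` are in the same relative order as the values of `q`. -/
def occ (n : ℕ) (q : Fin 3 → ℕ) (σ : Equiv.Perm (Fin n)) : ℕ :=
  (Finset.univ.filter fun ι : Fin 3 → Fin n =>
    (∀ j l : Fin 3, j < l → ι j < ι l) ∧
    (∀ j l : Fin 3, q j < q l ↔ σ (ι j) < σ (ι l))).card

/-- The set `S_n(R)` of permutations of `{1,…,n}` avoiding every pattern in `R`. -/
def avoiders (n : ℕ) (R : List (Fin 3 → ℕ)) : Finset (Equiv.Perm (Fin n)) :=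
  Finset.univ.filter fun σ => ∀ q ∈ R, occ n q σ = 0

/-- `f_q(S_n(R))`: the total number of occurrences of the pattern `q` among
all permutations in `S_n(R)`. -/
def fCnt (n : ℕ) (q : Fin 3 → ℕ) (R : List (Fin 3 → ℕ)) : ℕ :=
  ∑ σ ∈ avoiders n R, occ n q σ

def p123 : Fin 3 → ℕ := ![1, 2, 3]
def p132 : Fin 3 → ℕ := ![1, 3, 2]
def p213 : Fin 3 → ℕ := ![2, 1, 3]
def p231 : Fin 3 → ℕ := ![2, 3, 1]
def p312 : Fin 3 → ℕ := ![3, 1, 2]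
def p321 : Fin 3 → ℕ := ![3, 2, 1]

/-- The permutation with first value `a` whose remaining values are order-isomorphic to `τ`. -/
noncomputable def consPerm {n : ℕ} (a : Fin (n + 1)) (τ : Equiv.Perm (Fin n)) :
    Equiv.Perm (Fin (n + 1)) :=
  Equiv.ofBijective (Fin.cons a (fun i => a.succAbove (τ i)) : Fin (n + 1) → Fin (n + 1)) <| by
    refine Finite.injective_iff_bijective.mp (Fin.cons_injective_iff.mpr ⟨?_, ?_⟩)
    · rintro ⟨i, hi⟩
      exact Fin.succAbove_ne _ _ hi
    · exact Fin.succAbove_right_injective.comp τ.injective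

@[simp] lemma consPerm_zero {n : ℕ} (a : Fin (n + 1)) (τ : Equiv.Perm (Fin n)) :
    consPerm a τ 0 = a := rfl

@[simp] lemma consPerm_succ {n : ℕ} (a : Fin (n + 1)) (τ : Equiv.Perm (Fin n)) (i : Fin n) :
    consPerm a τ i.succ = a.succAbove (τ i) := rfl

lemma consPerm_bijective (n : ℕ) :
    Function.Bijective fun p : Fin (n + 1) × Equiv.Perm (Fin n) => consPerm p.1 p.2 := by
  rw [Fintype.bijective_iff_injective_and_card]
  constructor
  · rintro ⟨a, τ⟩ ⟨b, ρ⟩ h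
    have hab : a = b := by simpa using DFunLike.congr_fun h 0
    subst hab
    refine Prod.ext rfl (Equiv.ext fun i => ?_)
    have := DFunLike.congr_fun h i.succ
    simpa using this
  · simp [Fintype.card_perm, Nat.factorial_succ]

/-- The triple `(x, y, z)` has the same relative order as the values of `q`. -/
abbrev SameOrder {α : Type*} [LT α] (q : Fin 3 → ℕ) (x y z : α) : Prop :=
  ∀ j l : Fin 3, q j < q l ↔ ![x, y, z] j < ![x, y, z] l

/-- Number of pairs of positions `j < k` whose values under `τ` are related by `r`. -/
def pairCount {n : ℕ} (r : Fin n → Fin n → Prop) [DecidableRel r] (τ : Equiv.Perm (Fin n)) : ℕ :=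
  ∑ j, ∑ k, if j < k ∧ r (τ j) (τ k) then 1 else 0

lemma sum_fin_three_fun {α : Type*} [Fintype α] (g : (Fin 3 → α) → ℕ) :
    ∑ ι, g ι = ∑ i, ∑ j, ∑ k, g ![i, j, k] := by
  let e : (Fin 3 → α) ≃ α × α × α :=
    { toFun := fun ι => (ι 0, ι 1, ι 2)
      invFun := fun p => ![p.1, p.2.1, p.2.2]
      left_inv := fun ι => by ext i; fin_cases i <;> rfl
      right_inv := fun p => rfl }
  rw [← e.symm.sum_comp, Fintype.sum_prod_type]
  refine Finset.sum_congr rfl fun i _ => ?_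
  rw [Fintype.sum_prod_type]
  rfl

lemma occ_eq_sum (n : ℕ) (q : Fin 3 → ℕ) (σ : Equiv.Perm (Fin n)) :
    occ n q σ = ∑ i, ∑ j, ∑ k,
      if i < j ∧ j < k ∧ SameOrder q (σ i) (σ j) (σ k) then 1 else 0 := by
  rw [occ, Finset.card_filter, sum_fin_three_fun]
  refine Finset.sum_congr rfl fun i _ => Finset.sum_congr rfl fun j _ =>
    Finset.sum_congr rfl fun k _ => if_congr ?_ rfl rfl
  have h : (∀ a b : Fin 3, a < b → ![i, j, k] a < ![i, j, k] b) ↔ i < j ∧ j < k := by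
    simp only [Fin.forall_fin_succ]
    simp
    grind
  have h' : ∀ a, σ (![i, j, k] a) = ![σ i, σ j, σ k] a := by
    intro a; fin_cases a <;> rfl
  simp only [h, h', and_assoc]

lemma sameOrder_succAbove {n : ℕ} (a : Fin (n + 1)) (q : Fin 3 → ℕ) (x y z : Fin n) :
    SameOrder q (a.succAbove x) (a.succAbove y) (a.succAbove z) ↔ SameOrder q x y z := by
  have h : ∀ b, ![a.succAbove x, a.succAbove y, a.succAbove z] b = a.succAbove (![x, y, z] b) := by
    intro b; fin_cases b <;> rfl
  simp only [SameOrder, h, Fin.succAbove_lt_succAbove_iff]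

lemma occ_consPerm {n : ℕ} (q : Fin 3 → ℕ) (a : Fin (n + 1)) (τ : Equiv.Perm (Fin n)) :
    occ (n + 1) q (consPerm a τ) =
      pairCount (fun x y => SameOrder q a (a.succAbove x) (a.succAbove y)) τ + occ n q τ := by
  simp only [occ_eq_sum, Fin.sum_univ_succ, consPerm_zero, consPerm_succ, sameOrder_succAbove,
    pairCount, Fin.succ_lt_succ_iff, Fin.not_lt_zero, Fin.succ_pos, false_and, and_false, true_and,
    if_false, Finset.sum_const_zero, zero_add]

lemma pairCount_consPerm {n : ℕ} (r : Fin (n + 1) → Fin (n + 1) → Prop) [DecidableRel r]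
    (a : Fin (n + 1)) (τ : Equiv.Perm (Fin n)) :
    pairCount r (consPerm a τ) = (∑ x, if r a (a.succAbove x) then 1 else 0) +
      pairCount (fun x y => r (a.succAbove x) (a.succAbove y)) τ := by
  simp only [pairCount, Fin.sum_univ_succ, consPerm_zero, consPerm_succ, Fin.succ_lt_succ_iff,
    Fin.not_lt_zero, Fin.succ_pos, false_and, true_and, if_false, zero_add]
  rw [← Equiv.sum_comp τ fun x => if r a (a.succAbove x) then (1 : ℕ) else 0]

lemma pairCount_congr {n : ℕ} {r s : Fin n → Fin n → Prop} [DecidableRel r] [DecidableRel s]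
    (h : ∀ x y, x ≠ y → (r x y ↔ s x y)) (τ : Equiv.Perm (Fin n)) :
    pairCount r τ = pairCount s τ := by
  refine Finset.sum_congr rfl fun j _ => Finset.sum_congr rfl fun k _ =>
    if_congr (and_congr_right fun hjk => h _ _ (τ.injective.ne hjk.ne)) rfl rfl

lemma pairCount_add {n : ℕ} {r s t : Fin n → Fin n → Prop} [DecidableRel r] [DecidableRel s]
    [DecidableRel t] (h : ∀ x y, x ≠ y → (t x y ↔ r x y ∨ s x y))
    (hd : ∀ x y, r x y → ¬ s x y) (τ : Equiv.Perm (Fin n)) :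
    pairCount r τ + pairCount s τ = pairCount t τ := by
  simp only [pairCount, ← Finset.sum_add_distrib]
  refine Finset.sum_congr rfl fun j _ => Finset.sum_congr rfl fun k _ => ?_
  by_cases hjk : j < k
  · have h1 := h _ _ (τ.injective.ne hjk.ne)
    have h2 := hd (τ j) (τ k)
    by_cases hr : r (τ j) (τ k) <;> by_cases hs : s (τ j) (τ k) <;> simp_all
  · simp [hjk]

lemma pairCount_eq_zero_iff {n : ℕ} {r : Fin n → Fin n → Prop} [DecidableRel r]
    {τ : Equiv.Perm (Fin n)} :
    pairCount r τ = 0 ↔ ∀ j k, j < k → ¬ r (τ j) (τ k) := by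
  simp [pairCount]

lemma pairCount_eq_zero {n : ℕ} {r : Fin n → Fin n → Prop} [DecidableRel r]
    (h : ∀ x y, x ≠ y → ¬ r x y) (τ : Equiv.Perm (Fin n)) : pairCount r τ = 0 :=
  pairCount_eq_zero_iff.mpr fun _ _ hjk => h _ _ (τ.injective.ne hjk.ne)

section SameOrder

variable {α : Type*} [LinearOrder α] {x y z : α}

lemma sameOrder_p123 : SameOrder p123 x y z ↔ x < y ∧ y < z := by
  simp [SameOrder, p123, Fin.forall_fin_succ]; grind

lemma sameOrder_p132 : SameOrder p132 x y z ↔ x < z ∧ z < y := by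
  simp [SameOrder, p132, Fin.forall_fin_succ]; grind

lemma sameOrder_p213 : SameOrder p213 x y z ↔ y < x ∧ x < z := by
  simp [SameOrder, p213, Fin.forall_fin_succ]; grind

lemma sameOrder_p231 : SameOrder p231 x y z ↔ z < x ∧ x < y := by
  simp [SameOrder, p231, Fin.forall_fin_succ]; grind

lemma sameOrder_p312 : SameOrder p312 x y z ↔ y < z ∧ z < x := by
  simp [SameOrder, p312, Fin.forall_fin_succ]; grind

lemma sameOrder_p321 : SameOrder p321 x y z ↔ z < y ∧ y < x := by
  simp [SameOrder, p321, Fin.forall_fin_succ]; grind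

end SameOrder

lemma penultimate_lt_succAbove_iff {m : ℕ} (x : Fin (m + 1)) :
    (Fin.last m).castSucc < (Fin.last m).castSucc.succAbove x ↔ x = Fin.last m := by
  rw [Fin.lt_succAbove_iff_le_castSucc, Fin.castSucc_le_castSucc_iff, Fin.last_le_iff]

lemma succAbove_lt_penultimate_iff {m : ℕ} (x : Fin (m + 1)) :
    (Fin.last m).castSucc.succAbove x < (Fin.last m).castSucc ↔ x ≠ Fin.last m := by
  rw [Fin.succAbove_lt_iff_castSucc_lt, Fin.castSucc_lt_castSucc_iff, Fin.lt_last_iff_ne_last]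

lemma succAbove_penultimate_eq_last_iff {m : ℕ} (x : Fin (m + 1)) :
    (Fin.last m).castSucc.succAbove x = Fin.last (m + 1) ↔ x = Fin.last m := by
  refine Iff.trans ?_ (penultimate_lt_succAbove_iff x)
  rw [Fin.lt_def, Fin.ext_iff]
  have := ((Fin.last m).castSucc.succAbove x).is_lt
  simp only [Fin.val_last, Fin.val_castSucc]
  omega

lemma succAbove_last_lt_last {m : ℕ} (x : Fin m) : (Fin.last m).succAbove x < Fin.last m := by
  simp [Fin.castSucc_lt_last]

/-- Number of positions preceding the position of the maximal value. -/
def beforeMax {m : ℕ} (τ : Equiv.Perm (Fin (m + 1))) : ℕ :=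
  pairCount (fun _ y => y = Fin.last m) τ

/-- Number of positions following the position of the maximal value. -/
def afterMax {m : ℕ} (τ : Equiv.Perm (Fin (m + 1))) : ℕ :=
  pairCount (fun x _ => x = Fin.last m) τ

/-- Number of non-inversions. -/
def ascPairs {m : ℕ} (τ : Equiv.Perm (Fin m)) : ℕ := pairCount (fun x y => x < y) τ

/-- Number of inversions. -/
def descPairs {m : ℕ} (τ : Equiv.Perm (Fin m)) : ℕ := pairCount (fun x y => y < x) τ

section Recursion

variable {m : ℕ} (τ : Equiv.Perm (Fin (m + 1)))

lemma beforeMax_last : beforeMax (consPerm (Fin.last (m + 1)) τ) = 0 := by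
  rw [beforeMax, pairCount_consPerm, pairCount_eq_zero]
  · simp [(Fin.castSucc_lt_last _).ne]
  · exact fun x y _ => (succAbove_last_lt_last y).ne

lemma beforeMax_penultimate :
    beforeMax (consPerm (Fin.last m).castSucc τ) = beforeMax τ + 1 := by
  rw [beforeMax, pairCount_consPerm]
  simp only [succAbove_penultimate_eq_last_iff]
  rw [add_comm]
  simp [beforeMax]

lemma afterMax_last : afterMax (consPerm (Fin.last (m + 1)) τ) = m + 1 := by
  rw [afterMax, pairCount_consPerm, pairCount_eq_zero]
  · simp
  · exact fun x y _ => (succAbove_last_lt_last x).ne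

lemma afterMax_penultimate : afterMax (consPerm (Fin.last m).castSucc τ) = afterMax τ := by
  rw [afterMax, pairCount_consPerm]
  simp [succAbove_penultimate_eq_last_iff, (Fin.castSucc_lt_last _).ne, afterMax]

lemma ascPairs_last : ascPairs (consPerm (Fin.last (m + 1)) τ) = ascPairs τ := by
  rw [ascPairs, pairCount_consPerm]
  simp [(Fin.le_last _).not_gt, ascPairs]

lemma ascPairs_penultimate :
    ascPairs (consPerm (Fin.last m).castSucc τ) = ascPairs τ + 1 := by
  rw [ascPairs, pairCount_consPerm]
  simp only [penultimate_lt_succAbove_iff, Fin.succAbove_lt_succAbove_iff]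
  rw [add_comm]
  simp [ascPairs]

lemma descPairs_last : descPairs (consPerm (Fin.last (m + 1)) τ) = descPairs τ + (m + 1) := by
  rw [descPairs, pairCount_consPerm, add_comm]
  simp [Fin.castSucc_lt_last, descPairs]

lemma descPairs_penultimate : descPairs (consPerm (Fin.last m).castSucc τ) = descPairs τ + m := by
  rw [descPairs, pairCount_consPerm, add_comm]
  simp only [succAbove_lt_penultimate_iff, Fin.succAbove_lt_succAbove_iff]
  simp [descPairs, Finset.sum_ite, Finset.filter_ne']

lemma occ_p213_last : occ (m + 2) p213 (consPerm (Fin.last (m + 1)) τ) = occ (m + 1) p213 τ := by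
  rw [occ_consPerm, pairCount_eq_zero, zero_add]
  exact fun x y _ h => (succAbove_last_lt_last y).not_gt (sameOrder_p213.mp h).2

lemma occ_p213_penultimate :
    occ (m + 2) p213 (consPerm (Fin.last m).castSucc τ) = beforeMax τ + occ (m + 1) p213 τ := by
  rw [occ_consPerm, beforeMax]
  congr 1
  refine pairCount_congr (fun x y hxy => ?_) τ
  rw [sameOrder_p213, succAbove_lt_penultimate_iff, penultimate_lt_succAbove_iff]
  grind

lemma occ_p231_last : occ (m + 2) p231 (consPerm (Fin.last (m + 1)) τ) = occ (m + 1) p231 τ := by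
  rw [occ_consPerm, pairCount_eq_zero, zero_add]
  exact fun x y _ h => (succAbove_last_lt_last x).not_gt (sameOrder_p231.mp h).2

lemma occ_p231_penultimate :
    occ (m + 2) p231 (consPerm (Fin.last m).castSucc τ) = afterMax τ + occ (m + 1) p231 τ := by
  rw [occ_consPerm, afterMax]
  congr 1
  refine pairCount_congr (fun x y hxy => ?_) τ
  rw [sameOrder_p231, succAbove_lt_penultimate_iff, penultimate_lt_succAbove_iff]
  grind

lemma occ_p312_last :
    occ (m + 2) p312 (consPerm (Fin.last (m + 1)) τ) = ascPairs τ + occ (m + 1) p312 τ := by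
  rw [occ_consPerm, ascPairs]
  congr 1
  refine pairCount_congr (fun x y hxy => ?_) τ
  rw [sameOrder_p312, Fin.succAbove_lt_succAbove_iff]
  exact and_iff_left (succAbove_last_lt_last y)

lemma occ_p312_penultimate :
    occ (m + 2) p312 (consPerm (Fin.last m).castSucc τ) + beforeMax τ =
      ascPairs τ + occ (m + 1) p312 τ := by
  rw [occ_consPerm, ascPairs, beforeMax, add_right_comm]
  congr 1
  refine pairCount_add (fun x y hxy => ?_) (fun x y => ?_) τ <;>
    rw [sameOrder_p312, succAbove_lt_penultimate_iff, Fin.succAbove_lt_succAbove_iff]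
  · have := Fin.le_last x
    grind
  · tauto

lemma occ_p321_last :
    occ (m + 2) p321 (consPerm (Fin.last (m + 1)) τ) = descPairs τ + occ (m + 1) p321 τ := by
  rw [occ_consPerm, descPairs]
  congr 1
  refine pairCount_congr (fun x y hxy => ?_) τ
  rw [sameOrder_p321, Fin.succAbove_lt_succAbove_iff]
  exact and_iff_left (succAbove_last_lt_last x)

lemma occ_p321_penultimate :
    occ (m + 2) p321 (consPerm (Fin.last m).castSucc τ) + afterMax τ =
      descPairs τ + occ (m + 1) p321 τ := by
  rw [occ_consPerm, descPairs, afterMax, add_right_comm]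
  congr 1
  refine pairCount_add (fun x y hxy => ?_) (fun x y => ?_) τ <;>
    rw [sameOrder_p321, succAbove_lt_penultimate_iff, Fin.succAbove_lt_succAbove_iff]
  · have := Fin.le_last y
    grind
  · tauto

end Recursion

lemma mem_avoiders_p123_p132 {n : ℕ} {σ : Equiv.Perm (Fin n)} :
    σ ∈ avoiders n [p123, p132] ↔ occ n p123 σ = 0 ∧ occ n p132 σ = 0 := by
  simp [avoiders]

lemma consPerm_last_mem_avoiders {m : ℕ} {τ : Equiv.Perm (Fin (m + 1))} :
    consPerm (Fin.last (m + 1)) τ ∈ avoiders (m + 2) [p123, p132] ↔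
      τ ∈ avoiders (m + 1) [p123, p132] := by
  rw [mem_avoiders_p123_p132, mem_avoiders_p123_p132, occ_consPerm, occ_consPerm,
    pairCount_eq_zero, pairCount_eq_zero, zero_add, zero_add]
  · exact fun x y _ h => (Fin.le_last _).not_gt (sameOrder_p132.mp h).1
  · exact fun x y _ h => (Fin.le_last _).not_gt (sameOrder_p123.mp h).1

lemma consPerm_penultimate_mem_avoiders {m : ℕ} {τ : Equiv.Perm (Fin (m + 1))} :
    consPerm (Fin.last m).castSucc τ ∈ avoiders (m + 2) [p123, p132] ↔
      τ ∈ avoiders (m + 1) [p123, p132] := by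
  rw [mem_avoiders_p123_p132, mem_avoiders_p123_p132, occ_consPerm, occ_consPerm,
    pairCount_eq_zero, pairCount_eq_zero, zero_add, zero_add]
  · intro x y hxy h
    have h' := sameOrder_p132.mp h
    exact hxy (((penultimate_lt_succAbove_iff x).mp (h'.1.trans h'.2)).trans
      ((penultimate_lt_succAbove_iff y).mp h'.1).symm)
  · intro x y hxy h
    have h' := sameOrder_p123.mp h
    exact hxy (((penultimate_lt_succAbove_iff x).mp h'.1).trans
      ((penultimate_lt_succAbove_iff y).mp (h'.1.trans h'.2)).symm)

lemma consPerm_castSucc_castSucc_notMem_avoiders {m : ℕ} (a : Fin m)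
    (τ : Equiv.Perm (Fin (m + 1))) :
    consPerm a.castSucc.castSucc τ ∉ avoiders (m + 2) [p123, p132] := by
  rw [mem_avoiders_p123_p132, occ_consPerm, occ_consPerm, Nat.add_eq_zero_iff,
    Nat.add_eq_zero_iff, pairCount_eq_zero_iff, pairCount_eq_zero_iff]
  rintro ⟨⟨h1, -⟩, h2, -⟩
  have hx : a.castSucc.castSucc < a.castSucc.castSucc.succAbove a.succ := by
    rw [Fin.lt_succAbove_iff_le_castSucc, Fin.castSucc_le_castSucc_iff]
    exact (Fin.castSucc_lt_succ).le
  have hl : a.castSucc.castSucc < a.castSucc.castSucc.succAbove a.castSucc := by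
    rw [Fin.lt_succAbove_iff_le_castSucc]
  have hxl : a.castSucc.castSucc.succAbove a.castSucc < a.castSucc.castSucc.succAbove a.succ :=
    Fin.succAbove_lt_succAbove_iff.mpr Fin.castSucc_lt_succ
  have hne : τ.symm a.castSucc ≠ τ.symm a.succ :=
    τ.symm.injective.ne Fin.castSucc_lt_succ.ne
  rcases hne.lt_or_gt with h | h
  · have := h1 _ _ h
    simp only [Equiv.apply_symm_apply, sameOrder_p123] at this
    exact this ⟨hl, hxl⟩
  · have := h2 _ _ h
    simp only [Equiv.apply_symm_apply, sameOrder_p132] at this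
    exact this ⟨hl, hxl⟩

lemma sum_avoiders_succ {m : ℕ} (g : Equiv.Perm (Fin (m + 2)) → ℕ) :
    ∑ σ ∈ avoiders (m + 2) [p123, p132], g σ =
      ∑ τ ∈ avoiders (m + 1) [p123, p132],
        (g (consPerm (Fin.last m).castSucc τ) + g (consPerm (Fin.last (m + 1)) τ)) := by
  have h : ∀ (n : ℕ) (f : Equiv.Perm (Fin n) → ℕ), ∑ σ ∈ avoiders n [p123, p132], f σ =
      ∑ σ, if σ ∈ avoiders n [p123, p132] then f σ else 0 := fun n f => by simp
  rw [h, h, ← (Equiv.ofBijective _ (consPerm_bijective (m + 1))).sum_comp,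
    Fintype.sum_prod_type_right]
  refine Finset.sum_congr rfl fun τ _ => ?_
  simp only [Equiv.ofBijective_apply, Fin.sum_univ_castSucc (n := m + 1),
    Fin.sum_univ_castSucc (n := m), consPerm_castSucc_castSucc_notMem_avoiders,
    consPerm_penultimate_mem_avoiders, consPerm_last_mem_avoiders, if_false,
    Finset.sum_const_zero, zero_add]
  split_ifs <;> rfl

section Totals

variable (m : ℕ)

lemma card_avoiders : (avoiders (m + 1) [p123, p132]).card = 2 ^ m := by
  induction m with
  | zero => decide
  | succ m ih =>
    rw [Finset.card_eq_sum_ones, sum_avoiders_succ, Finset.sum_const, ih, smul_eq_mul, pow_succ]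

lemma sum_beforeMax : ∑ τ ∈ avoiders (m + 1) [p123, p132], beforeMax τ + 1 = 2 ^ m := by
  induction m with
  | zero => decide
  | succ m ih =>
    rw [sum_avoiders_succ]
    simp only [beforeMax_last, beforeMax_penultimate, add_zero, Finset.sum_add_distrib,
      Finset.sum_const, card_avoiders, smul_eq_mul]
    rw [pow_succ 2 m]
    omega

lemma sum_afterMax :
    ∑ τ ∈ avoiders (m + 1) [p123, p132], (afterMax τ : ℤ) = (m - 1) * 2 ^ m + 1 := by
  induction m with
  | zero => decide
  | succ m ih =>
    rw [← Nat.cast_sum] at ih ⊢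
    rw [sum_avoiders_succ]
    simp only [afterMax_last, afterMax_penultimate, Finset.sum_add_distrib,
      Finset.sum_const, card_avoiders, smul_eq_mul]
    push_cast at ih ⊢
    rw [ih]
    ring

lemma sum_ascPairs : 2 * ∑ τ ∈ avoiders (m + 1) [p123, p132], ascPairs τ = m * 2 ^ m := by
  induction m with
  | zero => decide
  | succ m ih =>
    rw [sum_avoiders_succ]
    simp only [ascPairs_last, ascPairs_penultimate, Finset.sum_add_distrib,
      Finset.sum_const, card_avoiders, smul_eq_mul]
    rw [pow_succ 2 m]
    linarith

lemma sum_descPairs : 2 * ∑ τ ∈ avoiders (m + 1) [p123, p132], descPairs τ = m ^ 2 * 2 ^ m := by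
  induction m with
  | zero => decide
  | succ m ih =>
    rw [sum_avoiders_succ]
    simp only [descPairs_last, descPairs_penultimate, Finset.sum_add_distrib,
      Finset.sum_const, card_avoiders, smul_eq_mul]
    rw [pow_succ 2 m]
    linarith

lemma fCnt_p213 : 2 * (fCnt (m + 1) p213 [p123, p132] : ℤ) = (m - 2) * 2 ^ m + 2 := by
  induction m with
  | zero => decide
  | succ m ih =>
    have h := sum_beforeMax m
    unfold fCnt at ih ⊢
    rw [sum_avoiders_succ]
    simp only [occ_p213_last, occ_p213_penultimate, Finset.sum_add_distrib]
    zify at h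
    push_cast at ih ⊢
    rw [pow_succ 2 m]
    linarith

lemma fCnt_p231 :
    4 * (fCnt (m + 1) p231 [p123, p132] : ℤ) = (m ^ 2 - 3 * m + 4) * 2 ^ m - 4 := by
  induction m with
  | zero => decide
  | succ m ih =>
    have h := sum_afterMax m
    unfold fCnt at ih ⊢
    rw [sum_avoiders_succ]
    simp only [occ_p231_last, occ_p231_penultimate, Finset.sum_add_distrib]
    push_cast at ih ⊢
    rw [pow_succ 2 m]
    linarith

lemma fCnt_p312 :
    4 * (fCnt (m + 1) p312 [p123, p132] : ℤ) = (m ^ 2 - 3 * m + 4) * 2 ^ m - 4 := by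
  induction m with
  | zero => decide
  | succ m ih =>
    have h := sum_beforeMax m
    have h' := sum_ascPairs m
    have hp := Finset.sum_congr (rfl : avoiders (m + 1) [p123, p132] = _)
      fun τ _ => occ_p312_penultimate τ
    unfold fCnt at ih ⊢
    rw [sum_avoiders_succ]
    simp only [occ_p312_last, Finset.sum_add_distrib] at hp ⊢
    zify at h h' hp
    push_cast at ih ⊢
    rw [pow_succ 2 m]
    linarith

lemma fCnt_p321 :
    6 * (fCnt (m + 1) p321 [p123, p132] : ℤ) =
      (m ^ 3 - 3 * m ^ 2 + 5 * m - 6) * 2 ^ m + 6 := by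
  induction m with
  | zero => decide
  | succ m ih =>
    have h := sum_afterMax m
    have h' := sum_descPairs m
    have hp := Finset.sum_congr (rfl : avoiders (m + 1) [p123, p132] = _)
      fun τ _ => occ_p321_penultimate τ
    unfold fCnt at ih ⊢
    rw [sum_avoiders_succ]
    simp only [occ_p321_last, Finset.sum_add_distrib] at hp ⊢
    zify at h' hp
    push_cast at ih ⊢
    rw [pow_succ 2 m]
    linarith

end Totals

/-- Theorem `ta1`: pattern counts in `S_n(123,132)` for `n ≥ 3`. -/
theorem stmt_3 (n : ℕ) (hn : 3 ≤ n) :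
    (fCnt n p213 [p123, p132] : ℤ) = ((n : ℤ) - 3) * 2 ^ (n - 2) + 1 ∧
    fCnt n p231 [p123, p132] = fCnt n p312 [p123, p132] ∧
    (fCnt n p231 [p123, p132] : ℤ) = ((n : ℤ) ^ 2 - 5 * n + 8) * 2 ^ (n - 3) - 1 ∧
    3 * (fCnt n p321 [p123, p132] : ℤ) =
      ((n : ℤ) ^ 3 - 6 * n ^ 2 + 14 * n - 15) * 2 ^ (n - 2) + 3 := by
  obtain ⟨m, rfl⟩ := Nat.exists_eq_add_of_le' hn
  have h1 := fCnt_p213 (m + 2)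
  have h2 := fCnt_p231 (m + 2)
  have h3 := fCnt_p312 (m + 2)
  have h4 := fCnt_p321 (m + 2)
  rw [show m + 3 - 2 = m + 1 by omega, Nat.add_sub_cancel]
  push_cast [pow_succ] at h1 h2 h3 h4 ⊢
  refine ⟨by linarith, by zify; linarith, by linarith, by linarith⟩
end

section
/- For every integer n ≥ 3, the total number of occurrences of the pattern 123 in the set S_n(132,213) equals the sum over all compositions (c₁,…,c_k) of n of ∑_{i=1}^{k} binom(c_i, 3), and the total number of occurrences of the pattern 231 in S_n(132,213) equals the sum over all compositions (c₁,…,c_k) of n of ∑_{i=1}^{k−1} ∑_{j=i+1}^{k} c_j · binom(c_i, 2). -/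
open Finset

section ReverseLayered

variable {n : ℕ}

theorem occ_p132_eq_zero_iff (σ : Equiv.Perm (Fin n)) :
    occ n p132 σ = 0 ↔ ∀ a b c, a < b → b < c → σ a < σ c → ¬ σ c < σ b := by
  rw [occ, card_eq_zero, filter_eq_empty_iff]
  constructor
  · intro h a b c hab hbc h1 h2
    refine h (mem_univ ![a, b, c]) ?_
    simp [Fin.forall_fin_succ, p132]
    omega
  · rintro h ι - ⟨h1, h2⟩
    exact h (ι 0) (ι 1) (ι 2) (h1 _ _ (by decide)) (h1 _ _ (by decide))
      ((h2 _ _).1 (by decide)) ((h2 _ _).1 (by decide))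

theorem occ_p213_eq_zero_iff (σ : Equiv.Perm (Fin n)) :
    occ n p213 σ = 0 ↔ ∀ a b c, a < b → b < c → σ b < σ a → ¬ σ a < σ c := by
  rw [occ, card_eq_zero, filter_eq_empty_iff]
  constructor
  · intro h a b c hab hbc h1 h2
    refine h (mem_univ ![a, b, c]) ?_
    simp [Fin.forall_fin_succ, p213]
    omega
  · rintro h ι - ⟨h1, h2⟩
    exact h (ι 0) (ι 1) (ι 2) (h1 _ _ (by decide)) (h1 _ _ (by decide))
      ((h2 _ _).1 (by decide)) ((h2 _ _).1 (by decide))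

theorem mem_avoiders_iff (σ : Equiv.Perm (Fin n)) :
    σ ∈ avoiders n [p132, p213] ↔
      (∀ a b c, a < b → b < c → σ a < σ c → ¬ σ c < σ b) ∧
      ∀ a b c, a < b → b < c → σ b < σ a → ¬ σ a < σ c := by
  simp [avoiders, occ_p132_eq_zero_iff, occ_p213_eq_zero_iff]

theorem index_lt_index_iff (c : Composition n) (p q : Fin n) :
    c.index p < c.index q ↔ ∃ b ∈ c.boundaries, (p : ℕ) < b ∧ (b : ℕ) ≤ q := by
  constructor
  · intro h
    refine ⟨c.boundary (c.index p).succ, by simp [Composition.boundaries], ?_, ?_⟩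
    · exact c.lt_sizeUpTo_index_succ p
    · exact (c.monotone_sizeUpTo h).trans (c.sizeUpTo_index_le q)
  · rintro ⟨b, hb, hpb, hbq⟩
    obtain ⟨i, rfl⟩ : ∃ i, c.boundary i = b := by simpa [Composition.boundaries] using hb
    have h1 : (c.index p : ℕ) < i :=
      c.monotone_sizeUpTo.reflect_lt ((c.sizeUpTo_index_le p).trans_lt hpb)
    have h2 : (i : ℕ) < (c.index q : ℕ) + 1 :=
      c.monotone_sizeUpTo.reflect_lt (lt_of_le_of_lt hbq (c.lt_sizeUpTo_index_succ q))
    exact Fin.lt_def.2 (by omega)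

theorem index_mono (c : Composition n) : Monotone c.index := by
  intro p q hpq
  by_contra! h
  obtain ⟨b, -, h1, h2⟩ := (index_lt_index_iff c q p).1 h
  have := Fin.le_def.1 hpq
  omega

theorem boundaries_injective : Function.Injective (Composition.boundaries (n := n)) := by
  intro c c' h
  apply (compositionEquiv n).injective
  exact CompositionAsSet.ext h

/-- The key by which `reverseLayered` orders positions: later blocks first, and by position
inside each block. -/
def blockKey (c : Composition n) (p : Fin n) : (Fin c.length)ᵒᵈ ×ₗ Fin n :=
  toLex (OrderDual.toDual (c.index p), p)

/-- The permutation which is increasing on each block of `c`, and whose values on a block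
are larger than its values on all later blocks. -/
def reverseLayered (c : Composition n) : Equiv.Perm (Fin n) :=
  (Tuple.sort (blockKey c))⁻¹

theorem reverseLayered_lt_iff (c : Composition n) (p q : Fin n) :
    reverseLayered c p < reverseLayered c q ↔
      c.index q < c.index p ∨ c.index p = c.index q ∧ p < q := by
  have hinj : Function.Injective (blockKey c) := fun a b h =>
    congrArg (fun x => (ofLex x).2) h
  have hmono : StrictMono (blockKey c ∘ Tuple.sort (blockKey c)) :=
    (Tuple.monotone_sort _).strictMono_of_injective (hinj.comp (Equiv.injective _))
  rw [← hmono.lt_iff_lt]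
  simp [reverseLayered, blockKey, Prod.Lex.toLex_lt_toLex]

theorem reverseLayered_lt_iff_of_lt (c : Composition n) {p q : Fin n} (h : p < q) :
    reverseLayered c p < reverseLayered c q ↔ c.index p = c.index q := by
  have := index_mono c h.le
  rw [reverseLayered_lt_iff]
  omega

theorem reverseLayered_mem_avoiders (c : Composition n) :
    reverseLayered c ∈ avoiders n [p132, p213] := by
  rw [mem_avoiders_iff]
  refine ⟨fun x y z hxy hyz h => ?_, fun x y z hxy hyz h h' => ?_⟩
  · have := index_mono c hxy.le
    have := index_mono c hyz.le
    rw [reverseLayered_lt_iff_of_lt c (hxy.trans hyz)] at h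
    rw [reverseLayered_lt_iff]
    omega
  · have := index_mono c hxy.le
    have := index_mono c hyz.le
    rw [reverseLayered_lt_iff_of_lt c (hxy.trans hyz)] at h'
    rw [reverseLayered_lt_iff] at h
    omega

theorem mem_boundaries_iff (c : Composition n) (b : Fin (n + 1)) :
    b ∈ c.boundaries ↔ b = 0 ∨ b = Fin.last n ∨
      ∃ p q : Fin n, (p : ℕ) + 1 = b ∧ (q : ℕ) = b ∧ c.index p < c.index q := by
  constructor
  · intro hb
    by_cases h0 : b = 0
    · exact .inl h0
    by_cases h1 : b = Fin.last n
    · exact .inr (.inl h1)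
    have h0' : (b : ℕ) ≠ 0 := fun h => h0 (Fin.ext h)
    have h1' : (b : ℕ) ≠ n := fun h => h1 (Fin.ext h)
    refine .inr (.inr ⟨⟨b - 1, by omega⟩, ⟨b, by omega⟩, Nat.sub_add_cancel (by omega), rfl, ?_⟩)
    exact (index_lt_index_iff c _ _).2 ⟨b, hb, Nat.sub_lt (by omega) one_pos, le_rfl⟩
  · rintro (rfl | rfl | ⟨p, q, hp, hq, h⟩)
    · exact c.toCompositionAsSet.zero_mem
    · exact c.toCompositionAsSet.getLast_mem
    · obtain ⟨b', hb', h1, h2⟩ := (index_lt_index_iff c p q).1 h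
      rwa [show b = b' from Fin.ext (by omega)]

theorem reverseLayered_injective : Function.Injective (reverseLayered (n := n)) := by
  intro c c' h
  apply boundaries_injective
  ext b
  rw [mem_boundaries_iff, mem_boundaries_iff]
  have key : ∀ p q : Fin n, c.index p < c.index q ↔ c'.index p < c'.index q := by
    intro p q
    rcases lt_or_ge p q with hpq | hpq
    · have h1 := reverseLayered_lt_iff_of_lt c hpq
      rw [h, reverseLayered_lt_iff_of_lt c' hpq] at h1
      have := index_mono c hpq.le
      have := index_mono c' hpq.le
      omega
    · exact iff_of_false (index_mono c hpq).not_gt (index_mono c' hpq).not_gt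
  simp only [key]

theorem perm_ext_of_lt_iff {σ τ : Equiv.Perm (Fin n)}
    (h : ∀ p q, p < q → (σ p < σ q ↔ τ p < τ q)) : σ = τ := by
  have hm : StrictMono (σ ∘ τ.symm) := by
    intro x y hxy
    rcases lt_trichotomy (τ.symm x) (τ.symm y) with h1 | h1 | h1
    · exact (h _ _ h1).2 (by simpa using hxy)
    · exact absurd (τ.symm.injective h1) hxy.ne
    · have := h _ _ h1
      have hne : σ (τ.symm x) ≠ σ (τ.symm y) := by simpa using hxy.ne
      simp only [Equiv.apply_symm_apply, hxy.not_gt, iff_false] at this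
      exact lt_of_le_of_ne (not_lt.1 this) hne
  have hid := Subsingleton.elim (hm.orderIsoOfSurjective _ (σ.surjective.comp τ.symm.surjective))
    (OrderIso.refl (Fin n))
  ext p
  have := congrArg (fun e => ((e (τ p) : Fin n) : ℕ)) hid
  simpa using this

/-- In a permutation avoiding `132` and `213`, two positions form a non-inversion exactly when
there is no descent between them. -/
theorem lt_iff_forall_succ_lt {σ : Equiv.Perm (Fin n)} (hσ : σ ∈ avoiders n [p132, p213])
    {p q : Fin n} (hpq : p < q) :
    σ p < σ q ↔ ∀ r s : Fin n, p ≤ r → (r : ℕ) + 1 = s → s ≤ q → σ r < σ s := by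
  rw [mem_avoiders_iff] at hσ
  obtain ⟨h132, h213⟩ := hσ
  have between : ∀ {x y z}, x < y → y < z → σ x < σ z → σ x < σ y ∧ σ y < σ z := by
    intro x y z hxy hyz h
    have h1 := h132 x y z hxy hyz h
    have h2 := fun h' => h213 x y z hxy hyz h' h
    have h3 : σ x ≠ σ y := σ.injective.ne hxy.ne
    have h4 : σ y ≠ σ z := σ.injective.ne hyz.ne
    grind
  constructor
  · intro h r s hpr hrs hsq
    have hr : σ r < σ q := by
      rcases hpr.eq_or_lt with rfl | hpr
      · exact h
      · exact (between hpr (by omega) h).2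
    rcases hsq.eq_or_lt with rfl | hsq
    · exact hr
    · exact (between (by omega) hsq hr).1
  · intro h
    have key : ∀ k (hk : k < n), (p : ℕ) < k → k ≤ q → σ p < σ ⟨k, hk⟩ := by
      intro k
      induction k with
      | zero => intro _ h; omega
      | succ k ih =>
        intro hk h1 h2
        have hstep := h ⟨k, by omega⟩ ⟨k + 1, hk⟩ (Fin.le_def.2 (by simp; omega)) rfl
          (Fin.le_def.2 h2)
        rcases (show (p : ℕ) = k ∨ (p : ℕ) < k by omega) with h3 | h3
        · rwa [show (⟨k, by omega⟩ : Fin n) = p from Fin.ext h3.symm] at hstep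
        · exact (ih (by omega) h3 (by omega)).trans hstep
    exact key q q.2 hpq le_rfl

theorem exists_reverseLayered_eq {σ : Equiv.Perm (Fin n)}
    (hσ : σ ∈ avoiders n [p132, p213]) : ∃ c, reverseLayered c = σ := by
  classical
  let B : CompositionAsSet n :=
    { boundaries := univ.filter fun b => b = 0 ∨ b = Fin.last n ∨
        ∃ p q : Fin n, (p : ℕ) + 1 = b ∧ (q : ℕ) = b ∧ σ q < σ p
      zero_mem := by simp
      getLast_mem := by simp }
  have hB : B.toComposition.boundaries = B.boundaries := B.toComposition_boundaries
  refine ⟨B.toComposition, perm_ext_of_lt_iff fun p q hpq => ?_⟩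
  rw [reverseLayered_lt_iff_of_lt _ hpq, lt_iff_forall_succ_lt hσ hpq,
    ← not_iff_not]
  have hne : ¬ B.toComposition.index p = B.toComposition.index q ↔
      B.toComposition.index p < B.toComposition.index q := by
    have := index_mono B.toComposition hpq.le
    omega
  rw [hne, index_lt_index_iff, hB]
  constructor
  · rintro ⟨b, hb, h1, h2⟩ hall
    simp only [B, mem_filter, mem_univ, true_and] at hb
    rcases hb with rfl | rfl | ⟨r, s, hr, hs, h⟩
    · simp at h1
    · have := q.2
      simp at h2
      omega
    · exact (hall r s (by omega) (by omega) (by omega)).not_gt h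
  · intro h
    push Not at h
    obtain ⟨r, s, h1, h2, h3, h4⟩ := h
    refine ⟨s.castSucc, ?_, ?_, ?_⟩
    · simp only [B, mem_filter, mem_univ, true_and]
      refine .inr (.inr ⟨r, s, h2, rfl, lt_of_le_of_ne h4 (σ.injective.ne ?_)⟩)
      rintro rfl
      omega
    · simp; omega
    · simp; omega

theorem fCnt_eq_sum_reverseLayered (q : Fin 3 → ℕ) :
    fCnt n q [p132, p213] = ∑ c : Composition n, occ n q (reverseLayered c) := by
  symm
  refine sum_bij (fun c _ => reverseLayered c) (fun c _ => reverseLayered_mem_avoiders c)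
    (fun _ _ _ _ h => reverseLayered_injective h) (fun σ hσ => ?_) (fun _ _ => rfl)
  obtain ⟨c, hc⟩ := exists_reverseLayered_eq hσ
  exact ⟨c, mem_univ _, hc⟩

theorem card_filter_strictMono {α : Type*} [Fintype α] [LinearOrder α] (k : ℕ) (s : Finset α) :
    #{f : Fin k → α | StrictMono f ∧ ∀ i, f i ∈ s} = (#s).choose k := by
  classical
  rw [← card_powersetCard]
  refine card_bij (fun f _ => univ.image f) ?_ ?_ ?_
  · intro f hf
    simp only [mem_filter, mem_univ, true_and] at hf
    rw [mem_powersetCard, card_image_of_injective _ hf.1.injective]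
    exact ⟨by simpa [image_subset_iff] using hf.2, by simp⟩
  · intro f hf g hg h
    simp only [mem_filter, mem_univ, true_and] at hf hg
    refine (hf.1.range_inj hg.1).1 ?_
    simpa using congrArg (fun t : Finset α => (t : Set α)) h
  · intro t ht
    rw [mem_powersetCard] at ht
    refine ⟨t.orderEmbOfFin ht.2, ?_, ?_⟩
    · simp only [mem_filter, mem_univ, true_and]
      exact ⟨OrderEmbedding.strictMono _, fun i => ht.1 (orderEmbOfFin_mem t ht.2 i)⟩
    · apply coe_injective
      simp

theorem card_filter_index_eq (c : Composition n) (i : Fin c.length) :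
    #{p : Fin n | c.index p = i} = c.blocksFun i := by
  rw [← Fintype.card_fin (c.blocksFun i), ← card_univ, ← card_map (c.embedding i).toEmbedding]
  congr 1
  ext p
  have := c.mem_range_embedding_iff' (j := p) (i := i)
  simp only [Set.mem_range] at this
  simp [this, eq_comm (a := i)]

theorem occ_p123_reverseLayered (c : Composition n) :
    occ n p123 (reverseLayered c) = ∑ i, (c.blocksFun i).choose 3 := by
  rw [occ, card_eq_sum_card_fiberwise (f := fun ι => c.index (ι 0)) (t := univ)
    (fun _ _ => mem_coe.2 (mem_univ _))]
  refine sum_congr rfl fun i _ => ?_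
  rw [← card_filter_index_eq c i, ← card_filter_strictMono]
  congr 1
  ext ι
  simp only [mem_filter, mem_univ, true_and]
  constructor
  · rintro ⟨⟨h1, h2⟩, rfl⟩
    refine ⟨fun _ _ => h1 _ _, fun j => ?_⟩
    rcases (Fin.zero_le j).eq_or_lt with rfl | hj
    · rfl
    · refine ((reverseLayered_lt_iff_of_lt c (h1 _ _ hj)).1 ((h2 _ _).1 ?_)).symm
      revert j; decide
  · rintro ⟨h1, h2⟩
    refine ⟨⟨fun _ _ h => h1 h, fun j l => ?_⟩, h2 0⟩
    rw [reverseLayered_lt_iff, h2, h2, h1.lt_iff_lt]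
    simp only [lt_self_iff_false, false_or, true_and]
    revert j l; decide

theorem occ_p231_reverseLayered (c : Composition n) :
    occ n p231 (reverseLayered c) = ∑ i : Fin c.length, ∑ j : Fin c.length,
      if i < j then c.blocksFun j * (c.blocksFun i).choose 2 else 0 := by
  rw [occ, card_eq_sum_card_fiberwise (f := fun ι => (c.index (ι 0), c.index (ι 2)))
    (t := univ) (fun _ _ => mem_coe.2 (mem_univ _)), ← univ_product_univ, sum_product]
  refine sum_congr rfl fun i _ => sum_congr rfl fun j _ => ?_
  have mem_iff : ∀ ι : Fin 3 → Fin n,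
      (((∀ j l : Fin 3, j < l → ι j < ι l) ∧
        (∀ j l : Fin 3, p231 j < p231 l ↔
          reverseLayered c (ι j) < reverseLayered c (ι l))) ∧
        (c.index (ι 0), c.index (ι 2)) = (i, j)) ↔
      i < j ∧ ι 0 < ι 1 ∧ c.index (ι 0) = i ∧ c.index (ι 1) = i ∧ c.index (ι 2) = j := by
    intro ι
    rw [Prod.mk.injEq]
    constructor
    · rintro ⟨⟨h1, h2⟩, rfl, rfl⟩
      have h01 := h1 0 1 (by decide)
      have h02 := h1 0 2 (by decide)
      have e1 := (reverseLayered_lt_iff_of_lt c h01).1 ((h2 0 1).1 (by decide))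
      have e2 := mt ((reverseLayered_lt_iff_of_lt c h02).2) (mt (h2 0 2).2 (by decide))
      exact ⟨lt_of_le_of_ne (index_mono c h02.le) e2, h01, rfl, e1.symm, rfl⟩
    · rintro ⟨hij, h01, h0, h1, h2⟩
      have h12 : ι 1 < ι 2 := by
        by_contra! h
        have := index_mono c h
        omega
      refine ⟨⟨?_, ?_⟩, h0, h2⟩
      · simp [Fin.forall_fin_succ]
        omega
      · simp only [reverseLayered_lt_iff]
        simp [Fin.forall_fin_succ, p231, h0, h1, h2]
        omega
  simp only [filter_filter, mem_iff]
  split_ifs with hij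
  · rw [mul_comm, ← card_filter_index_eq c i, ← card_filter_strictMono,
      ← card_filter_index_eq c j, ← card_product]
    refine card_nbij' (fun ι => (![ι 0, ι 1], ι 2)) (fun x => ![x.1 0, x.1 1, x.2]) ?_ ?_ ?_ ?_
    · intro ι
      simp +contextual [Fin.forall_fin_succ, Fin.strictMono_iff_lt_succ]
    · rintro ⟨f, p⟩
      simp +contextual [Fin.forall_fin_succ, Fin.strictMono_iff_lt_succ, hij]
    · intro ι _
      ext k
      fin_cases k <;> rfl
    · rintro ⟨f, p⟩ _
      refine Prod.ext (funext fun k => ?_) rfl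
      fin_cases k <;> rfl
  · simp [hij]

end ReverseLayered

/-- Proposition `pb`: for `n ≥ 3`, `f_{123}(S_n(132,213))` is the sum over all compositions
`(c₁,…,c_k)` of `n` of `∑ᵢ C(cᵢ, 3)`, and `f_{231}(S_n(132,213))` is the sum over all
compositions of `n` of `∑_{i<j} c_j·C(c_i, 2)`. -/
theorem stmt_4 (n : ℕ) (hn : 3 ≤ n) :
    fCnt n p123 [p132, p213] =
      (∑ c : Composition n, ∑ i : Fin c.length, (c.blocksFun i).choose 3) ∧
    fCnt n p231 [p132, p213] =
      ∑ c : Composition n, ∑ i : Fin c.length, ∑ j : Fin c.length,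
        if i < j then c.blocksFun j * (c.blocksFun i).choose 2 else 0 := by
  refine ⟨?_, ?_⟩
  · simp only [fCnt_eq_sum_reverseLayered, occ_p123_reverseLayered]
  · simp only [fCnt_eq_sum_reverseLayered, occ_p231_reverseLayered]
end
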